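/- For every integer k ≥ 1 there exists a constant C_k > 0 such that α_{k,d} ≤ C_k/d² for all dimensions d ≥ 2. -/

import Mathlib

open MeasureTheory Real Filter

noncomputable section

/-- Euclidean space `ℝ^d`. -/
abbrev Euc (d : ℕ) := EuclideanSpace ℝ (Fin d)

/-- The Rayleigh quotient of a function `u` on a set `Ω ⊆ ℝ^d`. -/
noncomputable def rayleigh {d : ℕ} (Ω : Set (Euc d)) (u : Euc d → ℝ) : ℝ :=
  (∫ x in Ω, ‖fderiv ℝ u x‖ ^ 2) / (∫ x in Ω, (u x) ^ 2)

/-- The `k`-th Neumann eigenvalue of `Ω ⊆ ℝ^d`, defined by the variational (min-max)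
principle: the infimum, over all subspaces `V` of smooth functions `ℝ^d → ℝ` whose space of
restrictions to `Ω` is `(k+1)`-dimensional, of the supremum of the Rayleigh quotient over
the elements of `V` that are nonzero in `L²(Ω)`. -/
noncomputable def neumannEigenvalue {d : ℕ} (k : ℕ) (Ω : Set (Euc d)) : ℝ :=
  sInf { t : ℝ | ∃ V : Submodule ℝ (Euc d → ℝ),
    (∀ u ∈ V, ContDiff ℝ (⊤ : ℕ∞) u) ∧
    Module.finrank ℝ (V.map (LinearMap.funLeft ℝ ℝ ((↑) : Ω → Euc d))) = k + 1 ∧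
    t = sSup { r : ℝ | ∃ u ∈ V, (0 < ∫ x in Ω, (u x) ^ 2) ∧ r = rayleigh Ω u } }

/-- A nonempty bounded convex open subset of `ℝ^d`. -/
def IsConvexDomain {d : ℕ} (Ω : Set (Euc d)) : Prop :=
  Ω.Nonempty ∧ IsOpen Ω ∧ Bornology.IsBounded Ω ∧ Convex ℝ Ω

/-- The optimal constant `α_{k,d}`: the infimum of `μ_k(Ω₁)/μ_k(Ω₂)` over all pairs of
nonempty bounded convex open sets `Ω₁ ⊆ Ω₂ ⊂ ℝ^d`. -/
noncomputable def alphaConst (k d : ℕ) : ℝ :=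
  sInf { r : ℝ | ∃ Ω₁ Ω₂ : Set (Euc d), IsConvexDomain Ω₁ ∧ IsConvexDomain Ω₂ ∧ Ω₁ ⊆ Ω₂ ∧
    r = neumannEigenvalue k Ω₁ / neumannEigenvalue k Ω₂ }

/-- The Bessel function of the first kind of order `ν` (for `x > 0`). -/
noncomputable def besselJ (ν : ℝ) (x : ℝ) : ℝ :=
  ∑' m : ℕ, ((-1 : ℝ) ^ m / (m.factorial * Real.Gamma (m + ν + 1))) * (x / 2) ^ (2 * (m : ℝ) + ν)

/-- The first positive zero `j_{ν,1}` of the Bessel function `J_ν`. -/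
noncomputable def besselZero1 (ν : ℝ) : ℝ :=
  sInf {x : ℝ | 0 < x ∧ besselJ ν x = 0}

/-- The second positive zero `j_{ν,2}` of the Bessel function `J_ν`. -/
noncomputable def besselZero2 (ν : ℝ) : ℝ :=
  sInf {x : ℝ | besselZero1 ν < x ∧ besselJ ν x = 0}

/-- scaling of the Lebesgue integral on `ℝ^n` -/
lemma aux_lint_smul {n : ℕ} (g : (Fin n → ℝ) → ENNReal) (hg : Measurable g) {r : ℝ} (hr : 0 < r) :
    ∫⁻ y, g y = ENNReal.ofReal (r ^ n) * ∫⁻ y, g (r • y) := by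
  have h := Measure.map_addHaar_smul (volume : Measure (Fin n → ℝ)) hr.ne'
  have h2 : ∫⁻ y, g (r • y) = ENNReal.ofReal |(r ^ n)⁻¹| * ∫⁻ y, g y := by
    rw [← lintegral_map (μ := volume) (f := g) (g := fun y => r • y) hg (measurable_const_smul r)]
    rw [h, lintegral_smul_measure]
    simp
  rw [h2, ← mul_assoc, ← ENNReal.ofReal_mul (by positivity), abs_of_pos (by positivity),
    mul_inv_cancel₀ (by positivity)]
  simp

/-- Hardy-type inequality -/
lemma aux_hardy (n : ℕ) (a : ℝ → ℝ) (ha : ContDiff ℝ 1 a) (h1 : a 1 = 0) :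
    ∫ t in (0:ℝ)..1, t ^ n * a t ^ 2 ≤ 4 / ((n:ℝ) + 1) ^ 2 * ∫ t in (0:ℝ)..1, t ^ n * deriv a t ^ 2 := by
  have hac : Continuous a := ha.continuous
  have hdc : Continuous (deriv a) := ha.continuous_deriv le_rfl
  have hd : ∀ t, HasDerivAt a (deriv a t) t := fun t =>
    (ha.differentiable one_ne_zero t).hasDerivAt
  have ftc := intervalIntegral.integral_eq_sub_of_hasDerivAt (a := (0:ℝ)) (b := 1)
    (f := fun t => t ^ (n+1) * a t ^ 2)
    (f' := fun t => ((n:ℝ)+1) * (t ^ n * a t ^ 2) + 2 * (t ^ (n+1) * (a t * deriv a t)))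
    (by
      intro t _
      have := ((hasDerivAt_pow (n+1) t).mul ((hd t).pow 2))
      refine this.congr_deriv ?_
      simp
      ring)
    (by apply Continuous.intervalIntegrable; fun_prop)
  simp only [h1] at ftc
  rw [intervalIntegral.integral_add (by apply Continuous.intervalIntegrable; fun_prop)
    (by apply Continuous.intervalIntegrable; fun_prop), intervalIntegral.integral_const_mul,
    intervalIntegral.integral_const_mul] at ftc
  have hn : (0:ℝ) < (n:ℝ) + 1 := by positivity
  have key : - (2 * ∫ t in (0:ℝ)..1, t ^ (n+1) * (a t * deriv a t)) ≤
     ((n:ℝ)+1)/2 * (∫ t in (0:ℝ)..1, t ^ n * a t ^ 2) +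
      2 / ((n:ℝ)+1) * (∫ t in (0:ℝ)..1, t ^ n * deriv a t ^ 2) := by
    rw [← intervalIntegral.integral_const_mul, ← intervalIntegral.integral_const_mul,
      ← intervalIntegral.integral_const_mul, ← intervalIntegral.integral_neg,
      ← intervalIntegral.integral_add (by apply Continuous.intervalIntegrable; fun_prop)
      (by apply Continuous.intervalIntegrable; fun_prop)]
    apply intervalIntegral.integral_mono_on zero_le_one
      (by apply Continuous.intervalIntegrable; fun_prop)
      (by apply Continuous.intervalIntegrable; fun_prop)
    intro t ht
    have htn : 0 ≤ t ^ n := pow_nonneg ht.1 _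
    have e1 : -(2 * (t * a t * deriv a t)) ≤ ((n:ℝ)+1)/2 * a t ^ 2 + 2/((n:ℝ)+1) * deriv a t ^ 2 := by
      have : 0 ≤ (((n:ℝ)+1) * a t + 2 * t * deriv a t)^2 / (2 * ((n:ℝ)+1)) := by positivity
      have h3 : (((n:ℝ)+1) * a t + 2 * t * deriv a t)^2 / (2 * ((n:ℝ)+1)) =
        ((n:ℝ)+1)/2 * a t ^ 2 + 2 * (t * a t * deriv a t) + t^2 * (2/((n:ℝ)+1) * deriv a t ^ 2) := by
        field_simp
        ring
      have h4 : t^2 * (2/((n:ℝ)+1) * deriv a t ^ 2) ≤ 1 * (2/((n:ℝ)+1) * deriv a t ^ 2) := by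
        apply mul_le_mul_of_nonneg_right _ (by positivity)
        have := ht.1; have := ht.2; nlinarith
      linarith
    have := mul_le_mul_of_nonneg_left e1 htn
    calc _ = t ^ n * -(2 * (t * a t * deriv a t)) := by ring
      _ ≤ _ := this
      _ = _ := by ring
  simp only [ne_eq, OfNat.ofNat_ne_zero, not_false_eq_true, zero_pow, mul_zero] at ftc
  have h5 : ((n:ℝ)+1)/2 * (∫ t in (0:ℝ)..1, t ^ n * a t ^ 2) ≤
    2 / ((n:ℝ)+1) * (∫ t in (0:ℝ)..1, t ^ n * deriv a t ^ 2) := by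
    simp at ftc
    linarith
  have h6 := mul_le_mul_of_nonneg_left h5 (show 0 ≤ 2/((n:ℝ)+1) by positivity)
  calc _ = 2/((n:ℝ)+1) * (((n:ℝ)+1)/2 * (∫ t in (0:ℝ)..1, t ^ n * a t ^ 2)) := by
        field_simp
    _ ≤ _ := h6
    _ = _ := by rw [← mul_assoc]; congr 1; field_simp; norm_num

lemma aux_ofReal_interval (a b : ℝ) (hab : a ≤ b) (g : ℝ → ℝ) (hg : Continuous g)
    (h0 : ∀ t ∈ Set.Ioo a b, 0 ≤ g t) :
    ENNReal.ofReal (∫ t in a..b, g t) = ∫⁻ t in Set.Ioo a b, ENNReal.ofReal (g t) := by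
  rw [intervalIntegral.integral_of_le hab, integral_Ioc_eq_integral_Ioo,
    ofReal_integral_eq_lintegral_ofReal]
  · exact (hg.integrableOn_Icc).mono_set Set.Ioo_subset_Icc_self
  · exact (ae_restrict_iff' measurableSet_Ioo).2 (Eventually.of_forall h0)

lemma aux_hardy' (n : ℕ) (a : ℝ → ℝ) (ha : ContDiff ℝ 1 a) :
    ∫⁻ t in Set.Ioo (0:ℝ) 1, ENNReal.ofReal (t ^ n) * ENNReal.ofReal ((a t - a 1) ^ 2) ≤
     ENNReal.ofReal (4 / ((n:ℝ) + 1) ^ 2) *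
      ∫⁻ t in Set.Ioo (0:ℝ) 1, ENNReal.ofReal (t ^ n) * ENNReal.ofReal (deriv a t ^ 2) := by
  have hac : Continuous a := ha.continuous
  have hdc : Continuous (deriv a) := ha.continuous_deriv le_rfl
  have h := aux_hardy n (fun t => a t - a 1) (ha.sub contDiff_const) (by simp)
  have h' := ENNReal.ofReal_le_ofReal h
  simp only [deriv_sub_const] at h'
  rw [ENNReal.ofReal_mul (by positivity), aux_ofReal_interval _ _ zero_le_one _ (by fun_prop)
    (fun t ht => by have := ht.1; positivity),
    aux_ofReal_interval _ _ zero_le_one _ (by fun_prop)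
    (fun t ht => by have := ht.1; positivity)] at h'
  have e : ∀ g : ℝ → ℝ, ∫⁻ t in Set.Ioo (0:ℝ) 1, ENNReal.ofReal (t ^ n) * ENNReal.ofReal (g t) =
     ∫⁻ t in Set.Ioo (0:ℝ) 1, ENNReal.ofReal (t ^ n * g t) := by
    intro g
    refine setLIntegral_congr_fun measurableSet_Ioo (fun t ht => ?_)
    rw [ENNReal.ofReal_mul (pow_nonneg ht.1.le _)]
  rw [e, e]
  exact h'

lemma aux_ftc_sq (h : ℝ → ℝ) (hh : ContDiff ℝ 1 h) {b : ℝ} (hb : 0 ≤ b) :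
    (h b - h 0) ^ 2 ≤ b * ∫ s in (0:ℝ)..b, deriv h s ^ 2 := by
  have hdc : Continuous (deriv h) := hh.continuous_deriv le_rfl
  have ftc : ∫ s in (0:ℝ)..b, deriv h s = h b - h 0 := by
    apply intervalIntegral.integral_deriv_eq_sub
    · intro x _; exact hh.differentiable one_ne_zero x
    · exact hdc.intervalIntegrable _ _
  rcases hb.eq_or_lt with rfl | hb
  · simp
  set c := (h b - h 0) / b with hc
  have h0 : 0 ≤ ∫ s in (0:ℝ)..b, (deriv h s - c) ^ 2 :=
    intervalIntegral.integral_nonneg hb.le (fun s _ => sq_nonneg _)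
  have h1 : ∫ s in (0:ℝ)..b, (deriv h s - c) ^ 2 =
    (∫ s in (0:ℝ)..b, deriv h s ^ 2) - 2 * c * (h b - h 0) + b * c^2 := by
    rw [← ftc, ← intervalIntegral.integral_const_mul]
    have : b * c^2 = ∫ s in (0:ℝ)..b, c^2 := by simp
    rw [this, ← intervalIntegral.integral_sub (by apply Continuous.intervalIntegrable; fun_prop)
      (by apply Continuous.intervalIntegrable; fun_prop),
      ← intervalIntegral.integral_add (by apply Continuous.intervalIntegrable; fun_prop)
      (by apply Continuous.intervalIntegrable; fun_prop)]
    congr 1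
    ext s
    ring
  rw [h1, hc] at h0
  have h2 := mul_nonneg hb.le h0
  have h3 : b * ((∫ s in (0:ℝ)..b, deriv h s ^ 2) - 2 * ((h b - h 0) / b) * (h b - h 0) + b * ((h b - h 0) / b)^2)
    = b * (∫ s in (0:ℝ)..b, deriv h s ^ 2) - (h b - h 0)^2 := by
    field_simp
    ring
  linarith

/-- contraction towards `z` inside a ball -/
lemma aux_contract {n : ℕ} (g : (Fin n → ℝ) → ENNReal) (hg : Measurable g) {ε s : ℝ}
    (hs0 : 0 ≤ s) (hs : s ≤ 1/2) {z : Fin n → ℝ} (hz : z ∈ Metric.ball (0 : Fin n → ℝ) ε) :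
    ∫⁻ y in Metric.ball (0 : Fin n → ℝ) ε, g (y + s • (z - y)) ≤
     2 ^ n * ∫⁻ y in Metric.ball (0 : Fin n → ℝ) ε, g y := by
  set K := Metric.ball (0 : Fin n → ℝ) ε with hK
  have hKm : MeasurableSet K := Metric.isOpen_ball.measurableSet
  set r := 1 - s with hr
  have hr0 : 0 < r := by linarith
  have hgi : Measurable (K.indicator g) := hg.indicator hKm
  calc ∫⁻ y in K, g (y + s • (z - y)) ≤ ∫⁻ y, K.indicator g (r • y + s • z) := by
        rw [← lintegral_indicator hKm]
        apply lintegral_mono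
        intro y
        by_cases hy : y ∈ K
        · have e : y + s • (z - y) = r • y + s • z := by
            rw [hr]; ext i; simp; ring
          have hmem : r • y + s • z ∈ K :=
            (convex_ball (0 : Fin n → ℝ) ε) hy hz hr0.le hs0 (by rw [hr]; ring)
          simp [hy, hmem, e]
        · simp [hy]
    _ ≤ 2 ^ n * ENNReal.ofReal (r ^ n) * ∫⁻ y, K.indicator g (r • y + s • z) := by
        have : 1 ≤ 2 ^ n * ENNReal.ofReal (r ^ n) := by
          rw [ENNReal.ofReal_pow hr0.le, ← mul_pow]
          apply one_le_pow₀
          have : (2 : ENNReal) = ENNReal.ofReal 2 := by simp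
          rw [this, ← ENNReal.ofReal_mul (by norm_num)]
          rw [← ENNReal.ofReal_one]
          apply ENNReal.ofReal_le_ofReal
          linarith
        exact le_mul_of_one_le_left zero_le this
    _ = 2 ^ n * ∫⁻ y in K, g y := by
        rw [mul_assoc, ← aux_lint_smul (fun y => K.indicator g (y + s • z)) (by fun_prop) hr0,
          lintegral_add_right_eq_self (fun y => K.indicator g y), lintegral_indicator hKm]

lemma aux_sq_add (a b : ℝ) : ENNReal.ofReal ((a + b) ^ 2) ≤
    2 * ENNReal.ofReal (a ^ 2) + 2 * ENNReal.ofReal (b ^ 2) := by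
  have : (2 : ENNReal) = ENNReal.ofReal 2 := by simp
  rw [this, ← ENNReal.ofReal_mul (by norm_num), ← ENNReal.ofReal_mul (by norm_num),
    ← ENNReal.ofReal_add (by positivity) (by positivity)]
  apply ENNReal.ofReal_le_ofReal
  nlinarith [sq_nonneg (a - b)]

/-- bound for the difference with the midpoint -/
lemma aux_midpoint {n : ℕ} (f : (Fin n → ℝ) → ℝ) (hf : ContDiff ℝ 1 f) {ε : ℝ}
    {y z : Fin n → ℝ} (hy : y ∈ Metric.ball (0 : Fin n → ℝ) ε)
    (hz : z ∈ Metric.ball (0 : Fin n → ℝ) ε) :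
    ENNReal.ofReal ((f y - f ((1/2 : ℝ) • (y + z))) ^ 2) ≤
     ENNReal.ofReal (4 * ε ^ 2) *
      ∫⁻ s in Set.Ioo (0:ℝ) (1/2), ENNReal.ofReal (‖fderiv ℝ f (y + s • (z - y))‖ ^ 2) := by
  have hγ : ContDiff ℝ 1 (fun s : ℝ => y + s • (z - y)) := by fun_prop
  have hh : ContDiff ℝ 1 (fun s : ℝ => f (y + s • (z - y))) := hf.comp hγ
  have hfc : Continuous (fderiv ℝ f) := hf.continuous_fderiv one_ne_zero
  have hder : ∀ s, deriv (fun s : ℝ => f (y + s • (z - y))) s =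
      fderiv ℝ f (y + s • (z - y)) (z - y) := by
    intro s
    have h1 : HasDerivAt (fun s : ℝ => y + s • (z - y)) (z - y) s := by
      simpa using ((hasDerivAt_id s).smul_const (z - y)).const_add y
    exact ((hf.differentiable one_ne_zero _).hasFDerivAt.comp_hasDerivAt s h1).deriv
  have h := aux_ftc_sq _ hh (b := 1/2) (by norm_num)
  have hzy : ‖z - y‖ ≤ 2 * ε := by
    rw [mem_ball_zero_iff] at hy hz
    calc _ ≤ ‖z‖ + ‖y‖ := norm_sub_le _ _
      _ ≤ _ := by linarith
  have e : y + (1/2 : ℝ) • (z - y) = (1/2 : ℝ) • (y + z) := by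
    ext i; simp; ring
  have hintg : ∫ s in (0:ℝ)..(1/2), deriv (fun s : ℝ => f (y + s • (z - y))) s ^ 2 ≤
      ∫ s in (0:ℝ)..(1/2), 4 * ε ^ 2 * ‖fderiv ℝ f (y + s • (z - y))‖ ^ 2 := by
    have hc := hh.continuous_deriv le_rfl
    apply intervalIntegral.integral_mono_on (by norm_num)
      (by apply Continuous.intervalIntegrable; fun_prop)
      (by apply Continuous.intervalIntegrable; fun_prop)
    intro s _
    rw [hder s]
    have h1 := (fderiv ℝ f (y + s • (z - y))).le_opNorm (z - y)
    have h2 : ‖fderiv ℝ f (y + s • (z - y)) (z - y)‖ ≤ ‖fderiv ℝ f (y + s • (z - y))‖ * (2 * ε) :=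
      h1.trans (by gcongr)
    rw [← sq_abs, ← Real.norm_eq_abs]
    calc _ ≤ (‖fderiv ℝ f (y + s • (z - y))‖ * (2 * ε)) ^ 2 := by gcongr
      _ = _ := by ring
  have hnn : 0 ≤ ∫ s in (0:ℝ)..(1/2), deriv (fun s : ℝ => f (y + s • (z - y))) s ^ 2 :=
    intervalIntegral.integral_nonneg (by norm_num) (fun s _ => sq_nonneg _)
  rw [e] at h
  simp only [zero_smul, add_zero] at h
  rw [← aux_ofReal_interval 0 (1/2) (by norm_num) _ (by fun_prop) (fun _ _ => by positivity),
    ← ENNReal.ofReal_mul (by positivity)]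
  apply ENNReal.ofReal_le_ofReal
  rw [← intervalIntegral.integral_const_mul]
  calc _ = (f ((1/2 : ℝ) • (y + z)) - f y) ^ 2 := by ring
    _ ≤ _ := h
    _ ≤ _ := by linarith

lemma aux_poincare_ball {n : ℕ} (f : (Fin n → ℝ) → ℝ) (hf : ContDiff ℝ 1 f) (ε : ℝ) :
    ∫⁻ z in Metric.ball (0 : Fin n → ℝ) ε, ∫⁻ y in Metric.ball (0 : Fin n → ℝ) ε,
      ENNReal.ofReal ((f y - f z) ^ 2) ≤
     ENNReal.ofReal (16 * ε ^ 2) * 2 ^ n * (volume (Metric.ball (0 : Fin n → ℝ) ε) *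
      ∫⁻ y in Metric.ball (0 : Fin n → ℝ) ε, ENNReal.ofReal (‖fderiv ℝ f y‖ ^ 2)) := by
  set K := Metric.ball (0 : Fin n → ℝ) ε with hK
  have hKm : MeasurableSet K := Metric.isOpen_ball.measurableSet
  have hc : Continuous f := hf.continuous
  have hfc : Continuous (fderiv ℝ f) := hf.continuous_fderiv one_ne_zero
  set J := ∫⁻ y in K, ENNReal.ofReal (‖fderiv ℝ f y‖ ^ 2) with hJ
  set T := ∫⁻ z in K, ∫⁻ y in K, ENNReal.ofReal ((f y - f ((1/2 : ℝ) • (y + z))) ^ 2) with hT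
  have hTle : T ≤ ENNReal.ofReal (4 * ε ^ 2) * (2 ^ n * (volume K * J)) := by
    calc T ≤ ∫⁻ z in K, ∫⁻ y in K, ENNReal.ofReal (4 * ε ^ 2) *
          ∫⁻ s in Set.Ioo (0:ℝ) (1/2), ENNReal.ofReal (‖fderiv ℝ f (y + s • (z - y))‖ ^ 2) := by
          apply setLIntegral_mono' hKm
          intro z hz
          apply setLIntegral_mono' hKm
          intro y hy
          exact aux_midpoint f hf hy hz
      _ ≤ ∫⁻ z in K, ENNReal.ofReal (4 * ε ^ 2) * (2 ^ n * J) := by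
          apply setLIntegral_mono' hKm
          intro z hz
          rw [lintegral_const_mul' _ _ ENNReal.ofReal_ne_top]
          gcongr
          rw [lintegral_lintegral_swap (by
            apply Measurable.aemeasurable
            apply ENNReal.measurable_ofReal.comp
            apply Continuous.measurable
            fun_prop)]
          calc _ ≤ ∫⁻ s in Set.Ioo (0:ℝ) (1/2), 2 ^ n * J := by
                apply setLIntegral_mono' measurableSet_Ioo
                intro s hs
                exact aux_contract (fun y => ENNReal.ofReal (‖fderiv ℝ f y‖ ^ 2))
                  (ENNReal.measurable_ofReal.comp (by apply Continuous.measurable; fun_prop))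
                  hs.1.le hs.2.le hz
            _ ≤ 2 ^ n * J := by
                rw [setLIntegral_const]
                refine mul_le_of_le_one_right zero_le ?_
                rw [Real.volume_Ioo, ENNReal.ofReal_le_one]
                norm_num
      _ = _ := by
          rw [setLIntegral_const]; ring
  have hmain : ∫⁻ z in K, ∫⁻ y in K, ENNReal.ofReal ((f y - f z) ^ 2) ≤ 2 * T + 2 * T := by
    have hmeas1 : Measurable (fun p : (Fin n → ℝ) × (Fin n → ℝ) =>
        ENNReal.ofReal ((f p.2 - f ((1/2 : ℝ) • (p.2 + p.1))) ^ 2)) :=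
      ENNReal.measurable_ofReal.comp (by apply Continuous.measurable; fun_prop)
    have hmeas2 : Measurable (fun p : (Fin n → ℝ) × (Fin n → ℝ) =>
        ENNReal.ofReal ((f p.1 - f ((1/2 : ℝ) • (p.1 + p.2))) ^ 2)) :=
      ENNReal.measurable_ofReal.comp (by apply Continuous.measurable; fun_prop)
    calc _ ≤ ∫⁻ z in K, ∫⁻ y in K, (2 * ENNReal.ofReal ((f y - f ((1/2 : ℝ) • (y + z))) ^ 2) +
            2 * ENNReal.ofReal ((f z - f ((1/2 : ℝ) • (z + y))) ^ 2)) := by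
          apply lintegral_mono; intro z
          apply lintegral_mono; intro y
          have := aux_sq_add (f y - f ((1/2 : ℝ) • (y + z))) (f ((1/2 : ℝ) • (y + z)) - f z)
          simp only [sub_add_sub_cancel] at this
          refine this.trans (le_of_eq ?_)
          rw [show (f ((1/2 : ℝ) • (y + z)) - f z) ^ 2 = (f z - f ((1/2 : ℝ) • (z + y))) ^ 2 by
            rw [add_comm z y]; ring]
      _ = ∫⁻ z in K, (2 * (∫⁻ y in K, ENNReal.ofReal ((f y - f ((1/2 : ℝ) • (y + z))) ^ 2)) +
            2 * ∫⁻ y in K, ENNReal.ofReal ((f z - f ((1/2 : ℝ) • (z + y))) ^ 2)) := by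
          apply lintegral_congr; intro z
          rw [lintegral_add_left (by
            apply Measurable.const_mul
            exact hmeas1.comp (measurable_prodMk_left (x := z))),
            lintegral_const_mul' _ _ (by norm_num), lintegral_const_mul' _ _ (by norm_num)]
      _ = 2 * T + 2 * T := by
          rw [lintegral_add_left (by
            apply Measurable.const_mul
            exact hmeas1.lintegral_prod_right'),
            lintegral_const_mul' _ _ (by norm_num), lintegral_const_mul' _ _ (by norm_num)]
          congr 2
          rw [lintegral_lintegral_swap hmeas2.aemeasurable]
  calc _ ≤ 2 * T + 2 * T := hmain
    _ = 4 * T := by ring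
    _ ≤ 4 * (ENNReal.ofReal (4 * ε ^ 2) * (2 ^ n * (volume K * J))) := by gcongr
    _ = _ := by
      have h16 : ENNReal.ofReal (16 * ε ^ 2) = 4 * ENNReal.ofReal (4 * ε ^ 2) := by
        rw [show (16 * ε ^ 2) = 4 * (4 * ε ^ 2) by ring, ENNReal.ofReal_mul (p := 4) (by norm_num)]
        simp
      rw [h16]
      ring

/-- coordinates on `ℝ^(n+1)` -/
def auxL (n : ℕ) (p : ℝ × (Fin n → ℝ)) : Euc (n + 1) :=
  WithLp.toLp 2 (Fin.cons p.1 p.2 : Fin (n + 1) → ℝ)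

lemma auxL_zero {n : ℕ} (p : ℝ × (Fin n → ℝ)) : auxL n p 0 = p.1 := by simp [auxL]

lemma auxL_succ {n : ℕ} (p : ℝ × (Fin n → ℝ)) (i : Fin n) : auxL n p i.succ = p.2 i := by
  simp [auxL]

/-- measurable equivalence version of `auxL` -/
def auxLe (n : ℕ) : (ℝ × (Fin n → ℝ)) ≃ᵐ Euc (n + 1) :=
  (MeasurableEquiv.piFinSuccAbove (fun _ : Fin (n + 1) => ℝ) 0).symm.trans
    (MeasurableEquiv.toLp 2 (Fin (n + 1) → ℝ))

lemma auxLe_eq (n : ℕ) : ⇑(auxLe n) = auxL n := by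
  ext p i
  simp [auxLe, auxL, MeasurableEquiv.piFinSuccAbove]

lemma auxL_mp (n : ℕ) : MeasurePreserving (auxL n) volume volume := by
  rw [← auxLe_eq]
  exact (volume_preserving_piFinSuccAbove (fun _ : Fin (n + 1) => ℝ) 0).symm.trans
    (PiLp.volume_preserving_toLp (Fin (n + 1)))

lemma auxL_emb (n : ℕ) : MeasurableEmbedding (auxL n) := by
  rw [← auxLe_eq]; exact (auxLe n).measurableEmbedding

/-- linear version of `auxL` -/
def auxLl (n : ℕ) : (ℝ × (Fin n → ℝ)) →L[ℝ] Euc (n + 1) :=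
  LinearMap.toContinuousLinearMap
    { toFun := auxL n
      map_add' := by
        intro p q; ext i; refine Fin.cases ?_ (fun j => ?_) i <;> simp [auxL]
      map_smul' := by
        intro c p; ext i; refine Fin.cases ?_ (fun j => ?_) i <;> simp [auxL] }

lemma auxLl_eq (n : ℕ) : ⇑(auxLl n) = auxL n := rfl

/-- last coordinates -/
def auxTail (n : ℕ) (x : Euc (n + 1)) : Fin n → ℝ := fun i => x i.succ

lemma auxTail_L {n : ℕ} (p : ℝ × (Fin n → ℝ)) : auxTail n (auxL n p) = p.2 := by
  ext i; simp [auxTail, auxL]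

lemma auxTail_cont (n : ℕ) : Continuous (auxTail n) := by
  unfold auxTail; fun_prop

/-- the cone -/
def auxCone (n : ℕ) (ε : ℝ) : Set (Euc (n + 1)) :=
  {x | 0 < x 0 ∧ x 0 < 1 ∧ ‖auxTail n x‖ < ε * x 0}

/-- the box -/
def auxBox (n : ℕ) (ε : ℝ) : Set (Euc (n + 1)) :=
  {x | 1/2 < x 0 ∧ x 0 < 1 ∧ ‖auxTail n x‖ < ε / 2}

lemma auxBox_subset (n : ℕ) {ε : ℝ} (hε : 0 < ε) : auxBox n ε ⊆ auxCone n ε := by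
  rintro x ⟨h1, h2, h3⟩
  refine ⟨by linarith, h2, h3.trans ?_⟩
  nlinarith

lemma auxTail_comb {n : ℕ} (x y : Euc (n + 1)) (a b : ℝ) :
    auxTail n (a • x + b • y) = a • auxTail n x + b • auxTail n y := by
  ext i; simp [auxTail]

lemma aux_bounded {n : ℕ} {ε : ℝ} (hε : 0 < ε) : Bornology.IsBounded (auxCone n ε) := by
  have : auxCone n ε ⊆ (auxL n) '' ((Set.Icc (0:ℝ) 1) ×ˢ (Metric.closedBall (0 : Fin n → ℝ) ε)) := by
    rintro x ⟨h1, h2, h3⟩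
    refine ⟨(x 0, auxTail n x), ⟨⟨h1.le, h2.le⟩, ?_⟩, ?_⟩
    · simp only [mem_closedBall_zero_iff]
      nlinarith
    · ext i; refine Fin.cases ?_ (fun j => ?_) i <;> simp [auxL, auxTail]
  refine Bornology.IsBounded.subset ?_ this
  apply IsCompact.isBounded
  apply IsCompact.image
  · exact isCompact_Icc.prod (isCompact_closedBall _ _)
  · rw [← auxLl_eq]; exact (auxLl n).continuous

lemma auxCone_dom (n : ℕ) {ε : ℝ} (hε : 0 < ε) : IsConvexDomain (auxCone n ε) := by
  refine ⟨⟨auxL n (1/2, 0), ?_⟩, ?_, aux_bounded hε, ?_⟩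
  · simp only [auxCone, Set.mem_ofPred_eq, auxTail_L, auxL_zero]
    norm_num; exact hε
  · have := auxTail_cont n
    refine IsOpen.and ?_ (IsOpen.and ?_ ?_) <;> apply isOpen_lt <;> fun_prop
  · rintro x ⟨x1, x2, x3⟩ y ⟨y1, y2, y3⟩ a b ha hb hab
    have h1 : ‖a • auxTail n x + b • auxTail n y‖ ≤ a * ‖auxTail n x‖ + b * ‖auxTail n y‖ := by
      refine (norm_add_le _ _).trans ?_
      rw [norm_smul, norm_smul, Real.norm_of_nonneg ha, Real.norm_of_nonneg hb]
    refine ⟨?_, ?_, ?_⟩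
    · simp; rcases ha.eq_or_lt with rfl | ha
      · have : b = 1 := by linarith
        subst this; simpa using y1
      · positivity
    · simp; rcases ha.eq_or_lt with rfl | ha
      · have : b = 1 := by linarith
        subst this; simpa using y2
      · nlinarith
    · rw [auxTail_comb]
      refine h1.trans_lt ?_
      simp only [PiLp.add_apply, PiLp.smul_apply, smul_eq_mul]
      rcases ha.eq_or_lt with rfl | ha
      · have : b = 1 := by linarith
        subst this; simpa using y3
      · nlinarith

lemma auxBox_dom (n : ℕ) {ε : ℝ} (hε : 0 < ε) : IsConvexDomain (auxBox n ε) := by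
  refine ⟨⟨auxL n (3/4, 0), ?_⟩, ?_, (aux_bounded hε).subset (auxBox_subset n hε), ?_⟩
  · simp only [auxBox, Set.mem_ofPred_eq, auxTail_L, auxL_zero]
    norm_num; exact hε
  · have := auxTail_cont n
    refine IsOpen.and ?_ (IsOpen.and ?_ ?_) <;> apply isOpen_lt <;> fun_prop
  · rintro x ⟨x1, x2, x3⟩ y ⟨y1, y2, y3⟩ a b ha hb hab
    have h1 : ‖a • auxTail n x + b • auxTail n y‖ ≤ a * ‖auxTail n x‖ + b * ‖auxTail n y‖ := by
      refine (norm_add_le _ _).trans ?_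
      rw [norm_smul, norm_smul, Real.norm_of_nonneg ha, Real.norm_of_nonneg hb]
    have hb' : b = 1 - a := by linarith
    subst hb'
    refine ⟨?_, ?_, ?_⟩
    · simp; rcases ha.eq_or_lt with rfl | ha
      · simpa using y1
      · nlinarith
    · simp; rcases ha.eq_or_lt with rfl | ha
      · simpa using y2
      · nlinarith
    · rw [auxTail_comb]
      refine h1.trans_lt ?_
      rcases ha.eq_or_lt with rfl | ha
      · simpa using y3
      · nlinarith

lemma auxBox_integral (n : ℕ) (ε : ℝ) (h : ℝ → ℝ) :
    ∫ x in auxBox n ε, h (x 0) =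
      (∫ t in Set.Ioo (1/2 : ℝ) 1, h t) * (volume (Metric.ball (0 : Fin n → ℝ) (ε/2))).toReal := by
  rw [← (auxL_mp n).setIntegral_preimage_emb (auxL_emb n)]
  have hpre : auxL n ⁻¹' (auxBox n ε) = Set.Ioo (1/2 : ℝ) 1 ×ˢ Metric.ball (0 : Fin n → ℝ) (ε/2) := by
    ext p
    simp [auxBox, auxL_zero, auxTail_L, and_assoc]
  rw [hpre, Measure.volume_eq_prod, ← Measure.prod_restrict]
  have := integral_prod_mul (μ := (volume : Measure ℝ).restrict (Set.Ioo (1/2 : ℝ) 1))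
    (ν := (volume : Measure (Fin n → ℝ)).restrict (Metric.ball (0 : Fin n → ℝ) (ε/2)))
    h (fun _ => (1:ℝ))
  simp only [auxL_zero]
  simpa [Measure.real] using this

lemma auxCone_lintegral (n : ℕ) {ε : ℝ} (hε : 0 < ε) (F : Euc (n+1) → ENNReal) (hF : Measurable F) :
    ∫⁻ x in auxCone n ε, F x = ∫⁻ t in Set.Ioo (0:ℝ) 1, ENNReal.ofReal (t ^ n) *
      ∫⁻ y in Metric.ball (0 : Fin n → ℝ) ε, F (auxL n (t, t • y)) := by
  have hSm : MeasurableSet (auxCone n ε) := (auxCone_dom n hε).2.1.measurableSet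
  have hLm : Measurable (auxL n) := (auxL_emb n).measurable
  rw [← lintegral_indicator hSm, ← (auxL_mp n).lintegral_comp (hF.indicator hSm),
    Measure.volume_eq_prod, lintegral_prod (fun a => (auxCone n ε).indicator F (auxL n a))
      (((hF.indicator hSm).comp hLm).aemeasurable),
    ← lintegral_indicator measurableSet_Ioo]
  apply lintegral_congr
  intro t
  by_cases ht : t ∈ Set.Ioo (0:ℝ) 1
  · rw [Set.indicator_of_mem ht, aux_lint_smul (fun y => (auxCone n ε).indicator F (auxL n (t, y)))
      (((hF.indicator hSm).comp hLm).comp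
      measurable_prodMk_left) ht.1, ← lintegral_indicator Metric.isOpen_ball.measurableSet]
    congr 2
    ext y
    have ht0 := ht.1
    have : auxL n (t, t • y) ∈ auxCone n ε ↔ y ∈ Metric.ball (0 : Fin n → ℝ) ε := by
      simp only [auxCone, Set.mem_ofPred_eq, auxL_zero, auxTail_L, mem_ball_zero_iff, norm_smul,
        Real.norm_of_nonneg ht0.le]
      constructor
      · rintro ⟨_, _, h⟩
        rw [mul_comm] at h
        exact lt_of_mul_lt_mul_right h ht0.le
      · intro h
        refine ⟨ht.1, ht.2, ?_⟩
        rw [mul_comm]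
        exact mul_lt_mul_of_pos_right h ht0
    by_cases hy : y ∈ Metric.ball (0 : Fin n → ℝ) ε
    · rw [Set.indicator_of_mem hy]; exact Set.indicator_of_mem (this.2 hy) _
    · rw [Set.indicator_of_notMem hy]; exact Set.indicator_of_notMem (fun h => hy (this.1 h)) _
  · rw [Set.indicator_of_notMem ht]
    convert lintegral_zero with y
    apply Set.indicator_of_notMem
    rintro ⟨h1, h2, _⟩
    rw [auxL_zero] at h1 h2
    exact ht ⟨h1, h2⟩

lemma auxL_norm_one {n : ℕ} {ε : ℝ} (hε : n * ε ^ 2 ≤ 1) {z : Fin n → ℝ} (hz : ‖z‖ ≤ ε) :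
    ‖auxL n (1, z)‖ ^ 2 ≤ 2 := by
  rw [EuclideanSpace.real_norm_sq_eq, Fin.sum_univ_succ]
  simp only [auxL_zero, auxL_succ]
  have : ∑ i, z i ^ 2 ≤ ∑ _i : Fin n, ε ^ 2 := by
    apply Finset.sum_le_sum
    intro i _
    rw [← sq_abs]
    have := norm_le_pi_norm z i
    rw [Real.norm_eq_abs] at this
    gcongr
    linarith
  simp at this
  linarith

lemma auxL_norm_zero {n : ℕ} (h : Fin n → ℝ) :
    ‖auxL n (0, h)‖ ^ 2 ≤ n * ‖h‖ ^ 2 := by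
  rw [EuclideanSpace.real_norm_sq_eq, Fin.sum_univ_succ]
  simp only [auxL_zero, auxL_succ]
  have : ∑ i, h i ^ 2 ≤ ∑ _i : Fin n, ‖h‖ ^ 2 := by
    apply Finset.sum_le_sum
    intro i _
    rw [← sq_abs]
    have := norm_le_pi_norm h i
    rw [Real.norm_eq_abs] at this
    gcongr
  simp at this
  simpa using this

lemma aux_deriv_t {n : ℕ} (u : Euc (n+1) → ℝ) (hu : ContDiff ℝ 1 u) {ε : ℝ} (hε : n * ε ^ 2 ≤ 1)
    {z : Fin n → ℝ} (hz : ‖z‖ ≤ ε) (t : ℝ) :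
    deriv (fun t : ℝ => u (auxL n (t, t • z))) t ^ 2 ≤ 2 * ‖fderiv ℝ u (auxL n (t, t • z))‖ ^ 2 := by
  have h1 : HasDerivAt (fun t : ℝ => auxL n (t, t • z)) (auxL n (1, z)) t := by
    have h2 : HasDerivAt (fun t : ℝ => ((t, t • z) : ℝ × (Fin n → ℝ))) (1, z) t := by
      have := (hasDerivAt_id t).prodMk ((hasDerivAt_id t).smul_const z)
      simpa using this
    exact (auxLl n).hasFDerivAt.comp_hasDerivAt t h2
  have h3 := ((hu.differentiable one_ne_zero _).hasFDerivAt.comp_hasDerivAt t h1).deriv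
  have h4 : deriv (fun t : ℝ => u (auxL n (t, t • z))) t =
    fderiv ℝ u (auxL n (t, t • z)) (auxL n (1, z)) := h3
  rw [h4, ← sq_abs, ← Real.norm_eq_abs]
  calc _ ≤ (‖fderiv ℝ u (auxL n (t, t • z))‖ * ‖auxL n (1, z)‖) ^ 2 := by
        gcongr; exact ContinuousLinearMap.le_opNorm _ _
    _ = ‖auxL n (1, z)‖ ^ 2 * ‖fderiv ℝ u (auxL n (t, t • z))‖ ^ 2 := by ring
    _ ≤ _ := by gcongr; exact auxL_norm_one hε hz

lemma aux_fderiv_y {n : ℕ} (u : Euc (n+1) → ℝ) (hu : ContDiff ℝ 1 u) {t : ℝ}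
    (ht : t ∈ Set.Ioo (0:ℝ) 1) (y : Fin n → ℝ) :
    ‖fderiv ℝ (fun y : Fin n → ℝ => u (auxL n (t, t • y))) y‖ ^ 2 ≤
      n * ‖fderiv ℝ u (auxL n (t, t • y))‖ ^ 2 := by
  have h1 : HasFDerivAt (fun y : Fin n → ℝ => ((t, t • y) : ℝ × (Fin n → ℝ)))
      ((0 : (Fin n → ℝ) →L[ℝ] ℝ).prod (t • ContinuousLinearMap.id ℝ (Fin n → ℝ))) y :=
    (hasFDerivAt_const t y).prodMk ((hasFDerivAt_id y).const_smul t)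
  have h2 := (auxLl n).hasFDerivAt.comp y h1
  have h3 := ((hu.differentiable one_ne_zero _).hasFDerivAt.comp y h2).fderiv
  have h4 : fderiv ℝ (fun y : Fin n → ℝ => u (auxL n (t, t • y))) y = _ := h3
  rw [h4]
  have hb : ‖(fderiv ℝ u (auxL n (t, t • y))).comp ((auxLl n).comp
      ((0 : (Fin n → ℝ) →L[ℝ] ℝ).prod (t • ContinuousLinearMap.id ℝ (Fin n → ℝ))))‖ ≤
      ‖fderiv ℝ u (auxL n (t, t • y))‖ * Real.sqrt n := by
    apply ContinuousLinearMap.opNorm_le_bound _ (by positivity)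
    intro h
    have e : (auxLl n) (((0 : (Fin n → ℝ) →L[ℝ] ℝ).prod
      (t • ContinuousLinearMap.id ℝ (Fin n → ℝ))) h) = auxL n (0, t • h) := rfl
    rw [ContinuousLinearMap.comp_apply, ContinuousLinearMap.comp_apply, e]
    refine (ContinuousLinearMap.le_opNorm _ _).trans ?_
    rw [mul_assoc]
    gcongr
    refine (sq_le_sq₀ (norm_nonneg _) (by positivity)).1 ?_
    rw [mul_pow, Real.sq_sqrt (by positivity)]
    refine (auxL_norm_zero _).trans ?_
    gcongr
    rw [norm_smul, Real.norm_of_nonneg ht.1.le]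
    exact mul_le_of_le_one_left (norm_nonneg _) ht.2.le
  calc _ ≤ (‖fderiv ℝ u (auxL n (t, t • y))‖ * Real.sqrt n) ^ 2 := by
        gcongr; exact hb
    _ = _ := by rw [mul_pow, Real.sq_sqrt (by positivity)]; ring

lemma aux_integrable {d : ℕ} {Ω : Set (Euc d)} (hΩ : Bornology.IsBounded Ω) {f : Euc d → ℝ}
    (hf : Continuous f) : IntegrableOn f Ω := by
  have : IsCompact (closure Ω) := hΩ.isCompact_closure
  exact (hf.continuousOn.integrableOn_compact this).mono_set subset_closure

lemma aux_shift {d : ℕ} {Ω : Set (Euc d)} (hΩ : Bornology.IsBounded Ω) {u : Euc d → ℝ}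
    (hu : Continuous u) (h0 : ∫ x in Ω, u x = 0) (c : ℝ) :
    ENNReal.ofReal (∫ x in Ω, u x ^ 2) ≤ ∫⁻ x in Ω, ENNReal.ofReal ((u x - c) ^ 2) := by
  have hi : ∀ f : Euc d → ℝ, Continuous f → Integrable f (volume.restrict Ω) :=
    fun f hf => aux_integrable hΩ hf
  rw [← ofReal_integral_eq_lintegral_ofReal (hi _ (by fun_prop))
    (Eventually.of_forall fun x => sq_nonneg _)]
  apply ENNReal.ofReal_le_ofReal
  have e : ∫ x in Ω, (u x - c) ^ 2 = (∫ x in Ω, u x ^ 2) - 2 * c * (∫ x in Ω, u x) + ∫ _ in Ω, c ^ 2 := by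
    rw [← integral_const_mul, ← integral_sub (hi _ (by fun_prop)) (hi _ (by fun_prop)),
      ← integral_add (hi _ (by fun_prop)) (hi _ (by fun_prop))]
    congr 1; ext x; ring
  rw [e, h0]
  have : 0 ≤ ∫ _ in Ω, c ^ 2 := integral_nonneg fun _ => sq_nonneg _
  linarith

lemma aux_meas {n : ℕ} (A : ℝ → (Fin n → ℝ) → ENNReal)
    (hA : Measurable (fun p : ℝ × (Fin n → ℝ) => A p.1 p.2)) :
    Measurable (fun p : (Fin n → ℝ) × ℝ => ENNReal.ofReal (p.2 ^ n) * A p.2 p.1) := by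
  have h1 : Measurable (fun p : (Fin n → ℝ) × ℝ => A p.2 p.1) := hA.comp measurable_swap
  fun_prop

set_option maxHeartbeats 2000000 in
lemma aux_cone_poincare (n : ℕ) : ∃ ε : ℝ, 0 < ε ∧ ∀ u : Euc (n+1) → ℝ, ContDiff ℝ 1 u →
    ∫ x in auxCone n ε, u x = 0 →
    ∫ x in auxCone n ε, u x ^ 2 ≤ 17 / ((n:ℝ) + 1) ^ 2 * ∫ x in auxCone n ε, ‖fderiv ℝ u x‖ ^ 2 := by
  obtain ⟨ε, hε, hε1, hε2⟩ : ∃ ε : ℝ, 0 < ε ∧ n * ε ^ 2 ≤ 1 ∧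
      32 * ε ^ 2 * 2 ^ n * n ≤ 1 / ((n:ℝ) + 1) ^ 2 := by
    have hA : (0:ℝ) < 32 * 2 ^ n * ((n:ℝ) + 1) ^ 3 := by positivity
    refine ⟨Real.sqrt (1 / (32 * 2 ^ n * ((n:ℝ) + 1) ^ 3)), Real.sqrt_pos.2 (by positivity), ?_, ?_⟩
    · rw [Real.sq_sqrt (by positivity), mul_one_div, div_le_one hA]
      have h1 : (1:ℝ) ≤ 2 ^ n := one_le_pow₀ (by norm_num)
      have h2 : (n:ℝ) ≤ ((n:ℝ)+1)^3 := by
        have : (0:ℝ) ≤ n := by positivity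
        nlinarith [pow_nonneg this 2, pow_nonneg this 3]
      nlinarith
    · rw [Real.sq_sqrt (by positivity)]
      rw [show 32 * (1 / (32 * 2 ^ n * ((n:ℝ) + 1) ^ 3)) * 2 ^ n * n = n / ((n:ℝ)+1)^3 by
        field_simp]
      rw [div_le_div_iff₀ (by positivity) (by positivity)]
      have : (0:ℝ) ≤ ((n:ℝ)+1)^2 := by positivity
      nlinarith
  refine ⟨ε, hε, fun u hu h0 => ?_⟩
  set K := Metric.ball (0 : Fin n → ℝ) ε with hK
  have hKm : MeasurableSet K := Metric.isOpen_ball.measurableSet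
  have hc : Continuous u := hu.continuous
  have hfc : Continuous (fderiv ℝ u) := hu.continuous_fderiv one_ne_zero
  have hLc : Continuous (auxL n) := (auxLl n).continuous
  have hLd : ContDiff ℝ 1 (auxL n) := (auxLl n).contDiff
  have hbd : Bornology.IsBounded (auxCone n ε) := aux_bounded hε
  set X := ENNReal.ofReal (∫ x in auxCone n ε, u x ^ 2) with hX
  set J := ∫⁻ x in auxCone n ε, ENNReal.ofReal (‖fderiv ℝ u x‖ ^ 2) with hJ
  set w : ℝ → (Fin n → ℝ) → ℝ := fun t y => u (auxL n (t, t • y)) with hw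
  set G : ℝ → (Fin n → ℝ) → ENNReal := fun t y =>
    ENNReal.ofReal (‖fderiv ℝ u (auxL n (t, t • y))‖ ^ 2) with hG
  have hwc : Continuous (fun p : ℝ × (Fin n → ℝ) => w p.1 p.2) := by
    simp only [hw]; fun_prop
  have hGm : Measurable (fun p : ℝ × (Fin n → ℝ) => G p.1 p.2) :=
    ENNReal.measurable_ofReal.comp (by apply Continuous.measurable; fun_prop)
  have hwt : ∀ t, ContDiff ℝ 1 (w t) := by
    intro t; simp only [hw]; fun_prop
  have hwz : ∀ z, ContDiff ℝ 1 (fun t => w t z) := by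
    intro z; simp only [hw]; fun_prop
  have hJe : J = ∫⁻ t in Set.Ioo (0:ℝ) 1, ENNReal.ofReal (t ^ n) * ∫⁻ y in K, G t y :=
    auxCone_lintegral n hε _ (ENNReal.measurable_ofReal.comp
      (by apply Continuous.measurable; fun_prop))
  set A : ℝ → (Fin n → ℝ) → ENNReal := fun t z =>
    ∫⁻ y in K, ENNReal.ofReal ((w t y - w t z) ^ 2) with hA
  have hwtc : ∀ t, Continuous (w t) := fun t => (hwt t).continuous
  have hAm : Measurable (fun p : ℝ × (Fin n → ℝ) => A p.1 p.2) := by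
    apply Measurable.lintegral_prod_right' (f := fun q : (ℝ × (Fin n → ℝ)) × (Fin n → ℝ) =>
      ENNReal.ofReal ((w q.1.1 q.2 - w q.1.1 q.1.2) ^ 2))
    apply ENNReal.measurable_ofReal.comp
    apply Continuous.measurable
    simp only [hw]; fun_prop
  -- pointwise in `z`
  have step1 : ∀ z, X ≤ ∫⁻ t in Set.Ioo (0:ℝ) 1, ENNReal.ofReal (t ^ n) *
      (2 * A t z + 2 * (volume K * ENNReal.ofReal ((w t z - w 1 z) ^ 2))) := by
    intro z
    refine (aux_shift hbd hc h0 (w 1 z)).trans ?_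
    rw [auxCone_lintegral n hε (fun x => ENNReal.ofReal ((u x - w 1 z) ^ 2)) (ENNReal.measurable_ofReal.comp
      (by apply Continuous.measurable; fun_prop))]
    apply lintegral_mono; intro t
    dsimp only
    gcongr
    calc _ ≤ ∫⁻ y in K, (2 * ENNReal.ofReal ((w t y - w t z) ^ 2) +
            2 * ENNReal.ofReal ((w t z - w 1 z) ^ 2)) := by
          apply lintegral_mono; intro y
          have := aux_sq_add (w t y - w t z) (w t z - w 1 z)
          rw [sub_add_sub_cancel] at this
          exact this
      _ = _ := by
          have := hwtc t
          rw [lintegral_add_right _ measurable_const, lintegral_const_mul' _ _ (by norm_num),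
            setLIntegral_const]
          ring
  have step2 : volume K * X ≤ 2 * (∫⁻ z in K, ∫⁻ t in Set.Ioo (0:ℝ) 1, ENNReal.ofReal (t ^ n) * A t z) +
      2 * (volume K * ∫⁻ z in K, ∫⁻ t in Set.Ioo (0:ℝ) 1, ENNReal.ofReal (t ^ n) *
        ENNReal.ofReal ((w t z - w 1 z) ^ 2)) := by
    have hKfin : volume K ≠ ⊤ := measure_ball_lt_top.ne
    have hm1 : Measurable (fun p : (Fin n → ℝ) × ℝ => ENNReal.ofReal (p.2 ^ n) * A p.2 p.1) :=
      aux_meas A hAm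
    calc volume K * X = ∫⁻ z in K, X := by rw [setLIntegral_const, mul_comm]
      _ ≤ ∫⁻ z in K, ∫⁻ t in Set.Ioo (0:ℝ) 1, ENNReal.ofReal (t ^ n) *
      (2 * A t z + 2 * (volume K * ENNReal.ofReal ((w t z - w 1 z) ^ 2))) :=
        lintegral_mono fun z => step1 z
      _ = ∫⁻ z in K, (2 * (∫⁻ t in Set.Ioo (0:ℝ) 1, ENNReal.ofReal (t ^ n) * A t z) +
         2 * (volume K * ∫⁻ t in Set.Ioo (0:ℝ) 1, ENNReal.ofReal (t ^ n) *
        ENNReal.ofReal ((w t z - w 1 z) ^ 2))) := by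
          apply lintegral_congr; intro z
          have hmz : Measurable (fun t => ENNReal.ofReal (t ^ n) * A t z) :=
            hm1.comp (measurable_prodMk_left (x := z))
          rw [← lintegral_const_mul' _ _ hKfin, ← lintegral_const_mul' _ _ (by norm_num),
            ← lintegral_const_mul' _ _ (by norm_num), ← lintegral_add_left (hmz.const_mul _)]
          apply lintegral_congr; intro t
          ring
      _ = _ := by
          rw [lintegral_add_left (hm1.lintegral_prod_right'.const_mul _),
            lintegral_const_mul' _ _ (by norm_num), lintegral_const_mul' _ _ (by norm_num),
            lintegral_const_mul' _ _ hKfin]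
  have term1 : ∫⁻ z in K, ∫⁻ t in Set.Ioo (0:ℝ) 1, ENNReal.ofReal (t ^ n) * A t z ≤
      ENNReal.ofReal (16 * ε ^ 2) * 2 ^ n * volume K * n * J := by
    rw [lintegral_lintegral_swap (aux_meas A hAm).aemeasurable]
    calc _ ≤ ∫⁻ t in Set.Ioo (0:ℝ) 1, ENNReal.ofReal (16 * ε ^ 2) * 2 ^ n * volume K * n *
          (ENNReal.ofReal (t ^ n) * ∫⁻ y in K, G t y) := by
          apply setLIntegral_mono' measurableSet_Ioo
          intro t ht
          rw [lintegral_const_mul' _ _ ENNReal.ofReal_ne_top]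
          have h1 := aux_poincare_ball (w t) (hwt t) ε
          have h2 : ∫⁻ y in K, ENNReal.ofReal (‖fderiv ℝ (w t) y‖ ^ 2) ≤ n * ∫⁻ y in K, G t y := by
            rw [← lintegral_const_mul' _ _ (ENNReal.natCast_ne_top n)]
            apply lintegral_mono; intro y
            refine (ENNReal.ofReal_le_ofReal (aux_fderiv_y u hu ht y)).trans (le_of_eq ?_)
            rw [ENNReal.ofReal_mul (by positivity), ENNReal.ofReal_natCast]
          calc _ ≤ ENNReal.ofReal (t ^ n) * (ENNReal.ofReal (16 * ε ^ 2) * 2 ^ n * (volume K *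
                 (n * ∫⁻ y in K, G t y))) := by
                gcongr
                refine h1.trans ?_
                gcongr
            _ = _ := by ring
      _ = _ := by
          rw [lintegral_const_mul' _ _ (by finiteness), ← hJe]
  have term2 : ∫⁻ z in K, ∫⁻ t in Set.Ioo (0:ℝ) 1, ENNReal.ofReal (t ^ n) *
        ENNReal.ofReal ((w t z - w 1 z) ^ 2) ≤ ENNReal.ofReal (4 / ((n:ℝ)+1)^2) * (2 * J) := by
    calc _ ≤ ∫⁻ z in K, ENNReal.ofReal (4 / ((n:ℝ)+1)^2) * (2 *
          ∫⁻ t in Set.Ioo (0:ℝ) 1, ENNReal.ofReal (t ^ n) * G t z) := by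
          apply setLIntegral_mono' hKm
          intro z hz
          refine (aux_hardy' n (fun t => w t z) (hwz z)).trans ?_
          gcongr
          rw [← lintegral_const_mul' _ _ (by norm_num)]
          apply lintegral_mono; intro t
          have h1 := ENNReal.ofReal_le_ofReal
            (aux_deriv_t u hu hε1 (mem_ball_zero_iff.1 hz).le t)
          rw [ENNReal.ofReal_mul (by norm_num)] at h1
          calc _ ≤ ENNReal.ofReal (t ^ n) * (ENNReal.ofReal 2 * G t z) := by
                dsimp only; gcongr
            _ = _ := by simp only [ENNReal.ofReal_ofNat]; ring
      _ = _ := by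
          rw [lintegral_const_mul' _ _ (by finiteness), lintegral_const_mul' _ _ (by norm_num),
            lintegral_lintegral_swap (aux_meas G hGm).aemeasurable, hJe]
          congr 2
          apply lintegral_congr; intro t
          rw [lintegral_const_mul' _ _ ENNReal.ofReal_ne_top]
  have hκ0 : volume K ≠ 0 := (Metric.measure_ball_pos volume _ hε).ne'
  have hκ1 : volume K ≠ ⊤ := measure_ball_lt_top.ne
  have fin : volume K * X ≤ volume K * (ENNReal.ofReal (17 / ((n:ℝ)+1)^2) * J) := by
    have hco : ENNReal.ofReal (32 * ε ^ 2 * 2 ^ n * n) + ENNReal.ofReal (16 / ((n:ℝ)+1)^2) ≤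
        ENNReal.ofReal (17 / ((n:ℝ)+1)^2) := by
      rw [← ENNReal.ofReal_add (by positivity) (by positivity)]
      apply ENNReal.ofReal_le_ofReal
      have : 17 / ((n:ℝ)+1)^2 = 1 / ((n:ℝ)+1)^2 + 16 / ((n:ℝ)+1)^2 := by ring
      linarith
    have e1 : ENNReal.ofReal (32 * ε ^ 2 * 2 ^ n * n) = 2 * (ENNReal.ofReal (16 * ε ^ 2) * 2 ^ n * n) := by
      rw [show 32 * ε ^ 2 * 2 ^ n * n = 2 * ((16 * ε ^ 2) * 2 ^ n * n) by ring,
        ENNReal.ofReal_mul (p := 2) (by norm_num), ENNReal.ofReal_mul (by positivity),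
        ENNReal.ofReal_mul (p := 16 * ε ^ 2) (by positivity), ENNReal.ofReal_pow (by norm_num)]
      simp
    have e2 : ENNReal.ofReal (16 / ((n:ℝ)+1)^2) = 4 * ENNReal.ofReal (4 / ((n:ℝ)+1)^2) := by
      rw [show 16 / ((n:ℝ)+1)^2 = 4 * (4 / ((n:ℝ)+1)^2) by ring,
        ENNReal.ofReal_mul (p := 4) (by norm_num)]
      simp
    calc _ ≤ _ := step2
      _ ≤ 2 * (ENNReal.ofReal (16 * ε ^ 2) * 2 ^ n * volume K * n * J) +
          2 * (volume K * (ENNReal.ofReal (4 / ((n:ℝ)+1)^2) * (2 * J))) := by gcongr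
      _ = volume K * ((ENNReal.ofReal (32 * ε ^ 2 * 2 ^ n * n) +
            ENNReal.ofReal (16 / ((n:ℝ)+1)^2)) * J) := by
          rw [e1, e2]; ring
      _ ≤ _ := by gcongr
  have fin2 : X ≤ ENNReal.ofReal (17 / ((n:ℝ)+1)^2) * J :=
    (ENNReal.mul_le_mul_iff_right hκ0 hκ1).1 fin
  rw [hJ, ← ofReal_integral_eq_lintegral_ofReal (aux_integrable hbd (by fun_prop))
    (Eventually.of_forall fun x => sq_nonneg _), ← ENNReal.ofReal_mul (by positivity)] at fin2
  exact (ENNReal.ofReal_le_ofReal_iff (mul_nonneg (by positivity)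
    (integral_nonneg fun x => sq_nonneg _))).1 fin2

lemma aux_pos {X : Type*} [TopologicalSpace X] [MeasurableSpace X] [OpensMeasurableSpace X]
    (μ : Measure X) [μ.IsOpenPosMeasure] {Ω : Set X} (hΩ : IsOpen Ω) {f : X → ℝ}
    (hf : Continuous f) (hi : IntegrableOn (fun x => f x ^ 2) Ω μ) {x : X} (hx : x ∈ Ω)
    (hfx : f x ≠ 0) : 0 < ∫ x in Ω, f x ^ 2 ∂μ := by
  rw [setIntegral_pos_iff_support_of_nonneg_ae (Eventually.of_forall fun x => sq_nonneg _) hi]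
  apply IsOpen.measure_pos
  · exact ((hf.pow 2).isOpen_support).inter hΩ
  · exact ⟨x, by simpa using hfx, hx⟩

lemma aux_quad {X : Type*} [MeasurableSpace X] (μ : Measure X) {m : ℕ} (v g : Fin m → X → ℝ)
    (hv : ∀ i j, Integrable (fun x => v i x * v j x) μ)
    (hg : ∀ i, Integrable (fun x => g i x ^ 2) μ)
    (hpos : ∀ a : Fin m → ℝ, a ≠ 0 → 0 < ∫ x, (∑ i, a i * v i x) ^ 2 ∂μ) :
    ∃ C : ℝ, 0 ≤ C ∧ ∀ a : Fin m → ℝ,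
      ∫ x, (∑ i, |a i| * |g i x|) ^ 2 ∂μ ≤ C * ∫ x, (∑ i, a i * v i x) ^ 2 ∂μ := by
  set q : (Fin m → ℝ) → ℝ := fun a => ∫ x, (∑ i, a i * v i x) ^ 2 ∂μ with hq
  have hqe : ∀ a, q a = ∑ i, ∑ j, a i * a j * ∫ x, v i x * v j x ∂μ := by
    intro a
    simp only [hq]
    calc _ = ∫ x, ∑ i, ∑ j, (a i * a j) * (v i x * v j x) ∂μ := by
          congr 1; ext x
          rw [sq, Finset.sum_mul_sum]
          refine Finset.sum_congr rfl fun i _ => Finset.sum_congr rfl fun j _ => by ring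
      _ = _ := by
          rw [integral_finsetSum _ (fun i _ => integrable_finsetSum _
            (fun j _ => (hv i j).const_mul _))]
          refine Finset.sum_congr rfl fun i _ => ?_
          rw [integral_finsetSum _ (fun j _ => (hv i j).const_mul _)]
          refine Finset.sum_congr rfl fun j _ => ?_
          rw [integral_const_mul]
  have hqc : Continuous q := by
    have : q = fun a => ∑ i, ∑ j, a i * a j * ∫ x, v i x * v j x ∂μ := funext hqe
    rw [this]; fun_prop
  have hqs : ∀ (c : ℝ) a, q (c • a) = c ^ 2 * q a := by
    intro c a
    rw [hqe, hqe, Finset.mul_sum]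
    refine Finset.sum_congr rfl fun i _ => ?_
    rw [Finset.mul_sum]
    refine Finset.sum_congr rfl fun j _ => ?_
    simp; ring
  obtain ⟨c, hc, hcq⟩ : ∃ c : ℝ, 0 < c ∧ ∀ a, c * ‖a‖ ^ 2 ≤ q a := by
    rcases (Metric.sphere (0 : Fin m → ℝ) 1).eq_empty_or_nonempty with he | hne
    · refine ⟨1, one_pos, fun a => ?_⟩
      have ha : a = 0 := by
        by_contra h
        have : (‖a‖⁻¹ • a) ∈ Metric.sphere (0 : Fin m → ℝ) 1 := by
          simp [norm_smul, h]
        rw [he] at this; exact this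
      subst ha
      simp [hq]
    · obtain ⟨a0, ha0, hmin⟩ := (isCompact_sphere (0 : Fin m → ℝ) 1).exists_isMinOn hne
        hqc.continuousOn
      have ha0' : a0 ≠ 0 := by
        rintro rfl; simp at ha0
      refine ⟨q a0, hpos a0 ha0', fun a => ?_⟩
      by_cases h : a = 0
      · subst h; simp [hq]
      · have hmem : (‖a‖⁻¹ • a) ∈ Metric.sphere (0 : Fin m → ℝ) 1 := by
          simp [norm_smul, h]
        have h1 : q a0 ≤ q (‖a‖⁻¹ • a) := hmin hmem
        rw [hqs] at h1
        have hn : 0 < ‖a‖ := norm_pos_iff.2 h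
        calc q a0 * ‖a‖ ^ 2 ≤ (‖a‖⁻¹ ^ 2 * q a) * ‖a‖ ^ 2 := by gcongr
          _ = q a := by field_simp
  set S := ∑ i, ∫ x, g i x ^ 2 ∂μ with hS
  have hS0 : 0 ≤ S := Finset.sum_nonneg fun i _ => integral_nonneg fun x => sq_nonneg _
  refine ⟨m * S / c, by positivity, fun a => ?_⟩
  have h1 : ∫ x, (∑ i, |a i| * |g i x|) ^ 2 ∂μ ≤ ∫ x, m * ∑ i, ‖a‖ ^ 2 * g i x ^ 2 ∂μ := by
    apply integral_mono_of_nonneg (Eventually.of_forall fun x => sq_nonneg _)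
    · exact (integrable_finsetSum _ fun i _ => (hg i).const_mul _).const_mul _
    · refine Eventually.of_forall fun x => ?_
      dsimp only
      have h2 := sq_sum_le_card_mul_sum_sq (s := Finset.univ) (f := fun i => |a i| * |g i x|)
      simp only [Finset.card_univ, Fintype.card_fin] at h2
      refine h2.trans ?_
      gcongr with i _
      rw [mul_pow, sq_abs (g i x)]
      gcongr
      exact norm_le_pi_norm a i
  have h2 : ∫ x, m * ∑ i, ‖a‖ ^ 2 * g i x ^ 2 ∂μ = m * S * ‖a‖ ^ 2 := by
    rw [integral_const_mul, integral_finsetSum _ fun i _ => (hg i).const_mul _]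
    simp_rw [integral_const_mul]
    rw [← Finset.mul_sum]; ring
  calc _ ≤ _ := h1
    _ = m * S / c * (c * ‖a‖ ^ 2) := by rw [h2]; field_simp
    _ ≤ _ := by gcongr; exact hcq a

lemma aux_bdd {d k : ℕ} {Ω : Set (Euc d)} (hΩ : IsOpen Ω) (hb : Bornology.IsBounded Ω)
    (V : Submodule ℝ (Euc d → ℝ)) (hV : ∀ u ∈ V, ContDiff ℝ (⊤ : ℕ∞) u)
    (hfr : Module.finrank ℝ (V.map (LinearMap.funLeft ℝ ℝ ((↑) : Ω → Euc d))) = k + 1) :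
    BddAbove { r : ℝ | ∃ u ∈ V, (0 < ∫ x in Ω, (u x) ^ 2) ∧ r = rayleigh Ω u } := by
  set R := LinearMap.funLeft ℝ ℝ ((↑) : Ω → Euc d) with hR
  haveI : Module.Finite ℝ (V.map R) := Module.finite_of_finrank_pos (by omega)
  let b := Module.finBasis ℝ (V.map R)
  have hlift : ∀ i, ∃ v ∈ V, R v = (b i : Ω → ℝ) := fun i => Submodule.mem_map.1 (b i).2
  choose v hvV hvb using hlift
  have hvd : ∀ i, ContDiff ℝ (⊤ : ℕ∞) (v i) := fun i => hV _ (hvV i)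
  have hvc : ∀ i, Continuous (v i) := fun i => (hvd i).continuous
  have hvf : ∀ i, Continuous (fderiv ℝ (v i)) := fun i => (hvd i).continuous_fderiv (by simp)
  obtain ⟨C, hC0, hC⟩ := aux_quad (volume.restrict Ω) v (fun i x => ‖fderiv ℝ (v i) x‖)
    (fun i j => aux_integrable hb (by fun_prop)) (fun i => aux_integrable hb (by fun_prop))
    (by
      intro a ha
      have hex : ∃ x : Ω, ∑ i, a i * v i x ≠ 0 := by
        by_contra hcon
        push Not at hcon
        apply ha
        have h0 : ∑ i, a i • b i = 0 := by
          ext x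
          have h1 := hcon x
          have h2 : ((∑ i, a i • b i : V.map R) : Ω → ℝ) = ∑ i, a i • R (v i) := by
            push_cast; simp_rw [hvb]
          rw [h2]
          simpa [hR, LinearMap.funLeft_apply] using h1
        ext i
        exact Fintype.linearIndependent_iff.1 b.linearIndependent a h0 i
      obtain ⟨x, hx⟩ := hex
      exact aux_pos volume hΩ (f := fun x => ∑ i, a i * v i x) (by fun_prop)
        (aux_integrable hb (by fun_prop)) x.2 hx)
  refine ⟨C, ?_⟩
  rintro r ⟨u, huV, hupos, rfl⟩
  let a : Fin _ → ℝ := fun i => b.repr ⟨R u, Submodule.mem_map_of_mem huV⟩ i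
  have hua : ∀ x ∈ Ω, u x = ∑ i, a i * v i x := by
    intro x hx
    have h1 := b.sum_repr ⟨R u, Submodule.mem_map_of_mem huV⟩
    have h2 := congrArg (fun w : V.map R => (w : Ω → ℝ) ⟨x, hx⟩) h1
    have h3 : ((∑ i, a i • b i : V.map R) : Ω → ℝ) = ∑ i, a i • R (v i) := by
      push_cast; simp_rw [hvb]
    change ((∑ i, a i • b i : V.map R) : Ω → ℝ) ⟨x, hx⟩ = R u ⟨x, hx⟩ at h2
    rw [h3] at h2
    simpa [hR, LinearMap.funLeft_apply] using h2.symm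
  have e1 : ∫ x in Ω, u x ^ 2 = ∫ x in Ω, (∑ i, a i * v i x) ^ 2 :=
    setIntegral_congr_fun hΩ.measurableSet fun x hx => by simp only [hua x hx]
  have e2 : ∫ x in Ω, ‖fderiv ℝ u x‖ ^ 2 ≤ ∫ x in Ω, (∑ i, |a i| * |‖fderiv ℝ (v i) x‖|) ^ 2 := by
    apply integral_mono_of_nonneg (Eventually.of_forall fun x => sq_nonneg _)
      (aux_integrable hb (by fun_prop))
    refine (ae_restrict_iff' hΩ.measurableSet).2 (Eventually.of_forall fun x hx => ?_)
    dsimp only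
    have h1 : HasFDerivAt (fun x => ∑ i, a i * v i x) (∑ i, a i • fderiv ℝ (v i) x) x := by
      refine HasFDerivAt.fun_sum fun i _ => ?_
      exact (((hvd i).differentiable (by simp) x).hasFDerivAt).const_mul (a i)
    have h2 : u =ᶠ[nhds x] fun x => ∑ i, a i * v i x :=
      Filter.eventuallyEq_of_mem (hΩ.mem_nhds hx) hua
    rw [h2.fderiv_eq, h1.fderiv]
    gcongr
    refine (norm_sum_le _ _).trans (le_of_eq ?_)
    refine Finset.sum_congr rfl fun i _ => ?_
    rw [norm_smul, Real.norm_eq_abs, abs_norm]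
  rw [rayleigh, div_le_iff₀ hupos]
  exact e2.trans ((hC a).trans_eq (by rw [e1]))

lemma aux_nonneg {d : ℕ} (k : ℕ) (Ω : Set (Euc d)) : 0 ≤ neumannEigenvalue k Ω := by
  apply Real.sInf_nonneg
  rintro t ⟨V, _, _, rfl⟩
  apply Real.sSup_nonneg
  rintro r ⟨u, _, _, rfl⟩
  exact div_nonneg (integral_nonneg fun x => sq_nonneg _) (integral_nonneg fun x => sq_nonneg _)

lemma aux_bddBelow {d : ℕ} (k : ℕ) (Ω : Set (Euc d)) : BddBelow { t : ℝ | ∃ V : Submodule ℝ (Euc d → ℝ),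
    (∀ u ∈ V, ContDiff ℝ (⊤ : ℕ∞) u) ∧
    Module.finrank ℝ (V.map (LinearMap.funLeft ℝ ℝ ((↑) : Ω → Euc d))) = k + 1 ∧
    t = sSup { r : ℝ | ∃ u ∈ V, (0 < ∫ x in Ω, (u x) ^ 2) ∧ r = rayleigh Ω u } } := by
  refine ⟨0, ?_⟩
  rintro t ⟨V, _, _, rfl⟩
  apply Real.sSup_nonneg
  rintro r ⟨u, _, _, rfl⟩
  exact div_nonneg (integral_nonneg fun x => sq_nonneg _) (integral_nonneg fun x => sq_nonneg _)

lemma aux_lower {d k : ℕ} (hk : 1 ≤ k) {Ω : Set (Euc d)} (hΩ : IsOpen Ω)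
    (hb : Bornology.IsBounded Ω) {l : ℝ}
    (hP : ∀ u : Euc d → ℝ, ContDiff ℝ 1 u → ∫ x in Ω, u x = 0 →
      l * ∫ x in Ω, u x ^ 2 ≤ ∫ x in Ω, ‖fderiv ℝ u x‖ ^ 2) :
    neumannEigenvalue k Ω = 0 ∨ l ≤ neumannEigenvalue k Ω := by
  unfold neumannEigenvalue
  set S := { t : ℝ | ∃ V : Submodule ℝ (Euc d → ℝ),
    (∀ u ∈ V, ContDiff ℝ (⊤ : ℕ∞) u) ∧
    Module.finrank ℝ (V.map (LinearMap.funLeft ℝ ℝ ((↑) : Ω → Euc d))) = k + 1 ∧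
    t = sSup { r : ℝ | ∃ u ∈ V, (0 < ∫ x in Ω, (u x) ^ 2) ∧ r = rayleigh Ω u } } with hS
  rcases S.eq_empty_or_nonempty with he | hne
  · left; rw [he]; exact Real.sInf_empty
  right
  apply le_csInf hne
  rintro t ⟨V, hV, hfr, rfl⟩
  have hbd := aux_bdd hΩ hb V hV hfr
  set R := LinearMap.funLeft ℝ ℝ ((↑) : Ω → Euc d) with hR
  haveI : Module.Finite ℝ (V.map R) := Module.finite_of_finrank_pos (by omega)
  have h1lt : 1 < Module.finrank ℝ (V.map R) := by omega
  haveI : Nontrivial (V.map R) := Module.nontrivial_of_finrank_pos (R := ℝ) (by omega)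
  obtain ⟨w1, hw1⟩ := exists_ne (0 : V.map R)
  obtain ⟨w2, hw2⟩ := exists_linearIndependent_pair_of_one_lt_finrank h1lt hw1
  obtain ⟨u1, hu1V, hu1⟩ := Submodule.mem_map.1 w1.2
  obtain ⟨u2, hu2V, hu2⟩ := Submodule.mem_map.1 w2.2
  obtain ⟨u, huV, hu0, huR⟩ : ∃ u ∈ V, ∫ x in Ω, u x = 0 ∧ R u ≠ 0 := by
    by_cases h0 : ∫ x in Ω, u1 x = 0
    · refine ⟨u1, hu1V, h0, ?_⟩
      rw [hu1]; simpa using hw1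
    · refine ⟨(∫ x in Ω, u2 x) • u1 + (-∫ x in Ω, u1 x) • u2,
        V.add_mem (V.smul_mem _ hu1V) (V.smul_mem _ hu2V), ?_, ?_⟩
      · simp only [Pi.add_apply, Pi.smul_apply, smul_eq_mul]
        rw [integral_add ((aux_integrable hb (hV _ hu1V).continuous).const_mul _)
          ((aux_integrable hb (hV _ hu2V).continuous).const_mul _), integral_const_mul,
          integral_const_mul]
        ring
      · intro hcon
        rw [LinearIndependent.pair_iff] at hw2
        have h3 := hw2 (∫ x in Ω, u2 x) (-∫ x in Ω, u1 x) (by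
          apply Subtype.ext
          rw [map_add, map_smul, map_smul, hu1, hu2] at hcon
          simpa using hcon)
        exact h0 (by linarith [h3.2])
  have huc := (hV u huV).continuous
  have hpos : 0 < ∫ x in Ω, u x ^ 2 := by
    obtain ⟨x, hx⟩ := Function.ne_iff.1 huR
    exact aux_pos volume hΩ huc (aux_integrable hb (by fun_prop)) x.2 hx
  refine le_trans ?_ (le_csSup hbd ⟨u, huV, hpos, rfl⟩)
  rw [rayleigh, le_div_iff₀ hpos]
  exact hP u ((hV u huV).of_le (by exact_mod_cast le_top)) hu0

lemma aux_poly_ne {k : ℕ} (a : Fin (k+1) → ℝ) (ha : a ≠ 0) :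
    ∃ t ∈ Set.Ioo (1/2 : ℝ) 1, ∑ i, a i * t ^ (i : ℕ) ≠ 0 := by
  by_contra hcon
  push Not at hcon
  apply ha
  set p : Polynomial ℝ := ∑ i : Fin (k+1), Polynomial.C (a i) * Polynomial.X ^ (i : ℕ) with hp
  have hp0 : p = 0 := by
    apply Polynomial.eq_zero_of_infinite_isRoot
    refine (Set.Ioo_infinite (show (1/2 : ℝ) < 1 by norm_num)).mono ?_
    intro t ht
    have := hcon t ht
    simpa [hp, Polynomial.IsRoot, Polynomial.eval_finset_sum] using this
  ext i
  have h1 : p.coeff i = a i := by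
    simp [hp, Polynomial.finset_sum_coeff, Polynomial.coeff_X_pow, Fin.ext_iff,
      Finset.sum_ite_eq, ← Fin.ext_iff]
  rw [← h1, hp0]; simp

/-- polynomials in the first coordinate -/
def auxT (n k : ℕ) : (Fin (k+1) → ℝ) →ₗ[ℝ] (Euc (n+1) → ℝ) where
  toFun a := fun x => ∑ i, a i * x 0 ^ (i : ℕ)
  map_add' a b := by ext x; simp [add_mul, Finset.sum_add_distrib]
  map_smul' c a := by ext x; simp [Finset.mul_sum, mul_assoc]

lemma aux_upper (k : ℕ) : ∃ C : ℝ, 0 ≤ C ∧ ∀ (n : ℕ) (ε : ℝ), 0 < ε →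
    neumannEigenvalue k (auxBox n ε) ≤ C := by
  have hintg : ∀ f : ℝ → ℝ, Continuous f → IntegrableOn f (Set.Ioo (1/2:ℝ) 1) := fun f hf =>
    hf.integrableOn_Icc.mono_set Set.Ioo_subset_Icc_self
  obtain ⟨C, hC0, hC⟩ := aux_quad (volume.restrict (Set.Ioo (1/2:ℝ) 1))
    (fun (i : Fin (k+1)) t => t ^ (i : ℕ)) (fun i t => (i : ℕ) * t ^ ((i : ℕ) - 1))
    (fun i j => hintg _ (by fun_prop)) (fun i => hintg _ (by fun_prop))
    (by
      intro a ha
      obtain ⟨t, ht, hne⟩ := aux_poly_ne a ha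
      exact aux_pos volume isOpen_Ioo (f := fun t => ∑ i, a i * t ^ (i : ℕ)) (by fun_prop)
        (hintg _ (by fun_prop)) ht hne)
  refine ⟨C, hC0, fun n ε hε => ?_⟩
  obtain ⟨hne, hopen, hb, hconv⟩ := auxBox_dom n hε
  have hbK : 0 < ε / 2 := by positivity
  refine (csInf_le (aux_bddBelow k (auxBox n ε)) ⟨LinearMap.range (auxT n k), ?_, ?_, rfl⟩).trans ?_
  · rintro u ⟨a, rfl⟩
    change ContDiff ℝ (⊤ : ℕ∞) (fun x : Euc (n+1) => ∑ i, a i * x 0 ^ (i : ℕ))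
    fun_prop
  · rw [← LinearMap.range_comp, LinearMap.finrank_range_of_inj]
    · simp
    · rw [← LinearMap.ker_eq_bot, LinearMap.ker_eq_bot']
      intro a ha
      by_contra hane
      obtain ⟨t, ht, hne⟩ := aux_poly_ne a hane
      apply hne
      have hmem : auxL n (t, 0) ∈ auxBox n ε := by
        refine ⟨by rw [auxL_zero]; exact ht.1, by rw [auxL_zero]; exact ht.2, ?_⟩
        rw [auxTail_L]; simpa using hbK
      have := congrFun ha ⟨_, hmem⟩
      simpa [auxT, LinearMap.funLeft_apply, auxL_zero] using this
  · apply Real.sSup_le _ hC0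
    rintro r ⟨u, ⟨a, rfl⟩, hpos, rfl⟩
    rw [rayleigh, div_le_iff₀ hpos]
    have e1 := auxBox_integral n ε (fun t => (∑ i, a i * t ^ (i : ℕ)) ^ 2)
    have e2 := auxBox_integral n ε
      (fun t => (∑ i, |a i| * |((i : ℕ) : ℝ) * t ^ ((i : ℕ) - 1)|) ^ 2)
    change ∫ x in auxBox n ε, (auxT n k a x) ^ 2 = _ at e1
    have e3 : ∫ x in auxBox n ε, ‖fderiv ℝ (auxT n k a) x‖ ^ 2 ≤
        ∫ x in auxBox n ε, (∑ i, |a i| * |((i : ℕ) : ℝ) * (x 0) ^ ((i : ℕ) - 1)|) ^ 2 := by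
      apply integral_mono_of_nonneg (Eventually.of_forall fun x => sq_nonneg _)
        (aux_integrable hb (by fun_prop))
      refine Eventually.of_forall fun x => ?_
      dsimp only
      have hp : HasFDerivAt (fun x : Euc (n+1) => x 0) (EuclideanSpace.proj (𝕜 := ℝ) (0 : Fin (n+1))) x :=
        (EuclideanSpace.proj (0 : Fin (n+1)) : Euc (n+1) →L[ℝ] ℝ).hasFDerivAt
      have h1 : HasFDerivAt (auxT n k a) (∑ i, a i • ((((i : ℕ) : ℝ) * x 0 ^ ((i : ℕ) - 1)) •
          (EuclideanSpace.proj (0 : Fin (n+1)) : Euc (n+1) →L[ℝ] ℝ))) x := by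
        change HasFDerivAt (fun x : Euc (n+1) => ∑ i, a i * x 0 ^ (i : ℕ)) _ x
        refine HasFDerivAt.fun_sum fun i _ => ?_
        refine HasFDerivAt.const_mul ?_ (a i)
        exact (hasDerivAt_pow (i : ℕ) (x 0)).comp_hasFDerivAt x hp
      have hpn : ‖(EuclideanSpace.proj (0 : Fin (n+1)) : Euc (n+1) →L[ℝ] ℝ)‖ ≤ 1 := by
        apply ContinuousLinearMap.opNorm_le_bound _ zero_le_one
        intro y
        rw [one_mul]
        exact PiLp.norm_apply_le y 0
      rw [h1.fderiv]
      gcongr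
      refine (norm_sum_le _ _).trans ?_
      gcongr with i _
      rw [norm_smul, norm_smul, Real.norm_eq_abs, Real.norm_eq_abs]
      gcongr
      exact mul_le_of_le_one_right (abs_nonneg _) hpn
    refine e3.trans ?_
    rw [e2, e1, ← mul_assoc]
    gcongr
    exact hC a

/-- for each `k ≥ 1` there is `C_k > 0` with `α_{k,d} ≤ C_k/d²` for all `d ≥ 2`. -/
theorem alpha_decay_in_dimension
    (k : ℕ) (hk : 1 ≤ k) :
    ∃ C : ℝ, 0 < C ∧ ∀ d : ℕ, 2 ≤ d → alphaConst k d ≤ C / (d : ℝ) ^ 2 := by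
  obtain ⟨C, hC0, hC⟩ := aux_upper k
  refine ⟨17 * C + 1, by positivity, fun d hd => ?_⟩
  obtain ⟨n, rfl⟩ : ∃ n, d = n + 1 := ⟨d - 1, by omega⟩
  obtain ⟨ε, hε, hP⟩ := aux_cone_poincare n
  have hdom := auxCone_dom n hε
  have hlow := aux_lower hk hdom.2.1 hdom.2.2.1 (l := ((n:ℝ)+1)^2 / 17) (by
    intro u hu h0
    have h1 := hP u hu h0
    have hn : (0:ℝ) < ((n:ℝ)+1)^2 / 17 := by positivity
    have h2 := mul_le_mul_of_nonneg_left h1 hn.le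
    refine h2.trans (le_of_eq ?_)
    rw [← mul_assoc]
    field_simp)
  have hbd : BddBelow { r : ℝ | ∃ Ω₁ Ω₂ : Set (Euc (n+1)), IsConvexDomain Ω₁ ∧ IsConvexDomain Ω₂ ∧
      Ω₁ ⊆ Ω₂ ∧ r = neumannEigenvalue k Ω₁ / neumannEigenvalue k Ω₂ } := by
    refine ⟨0, ?_⟩
    rintro r ⟨Ω₁, Ω₂, _, _, _, rfl⟩
    exact div_nonneg (aux_nonneg _ _) (aux_nonneg _ _)
  refine (csInf_le hbd ⟨auxBox n ε, auxCone n ε, auxBox_dom n hε, hdom,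
    auxBox_subset n hε, rfl⟩).trans ?_
  push_cast
  rcases hlow with h | h
  · rw [h, div_zero]; positivity
  · have hn : (0:ℝ) < ((n:ℝ)+1)^2 / 17 := by positivity
    calc _ ≤ C / (((n:ℝ)+1)^2 / 17) := div_le_div₀ hC0 (hC n ε hε) hn h
      _ = 17 * C / ((n:ℝ)+1)^2 := by field_simp
      _ ≤ _ := by gcongr; linarith

end
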